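/- There exists an absolute constant A₀ > 0 with the following property: for every arc J ⊆ 𝕋 with arclength |J| ≤ 1/8, every real L > 0 with L·|J| ≤ 1, and every b ∈ L¹(𝕋) supported in J, one has |(b ∗ φ_L)(x)| ≤ A₀ ‖b‖_{L¹(𝕋)} |J|^{-1} (χ_J ∗ φ_L)(x) for all x ∈ 𝕋. -/

import Mathlib

open MeasureTheory Real
open scoped ENNReal

noncomputable section

instance : Fact (0 < 2 * π) := ⟨by positivity⟩

/-- The torus `ℝ/(2πℤ)`. -/
abbrev Tor := AddCircle (2 * π)

/-- The normalized Haar measure `(2π)⁻¹ dx` on the torus. -/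
def haarT : Measure Tor := AddCircle.haarAddCircle

/-- Normalized convolution on the torus: `(f ∗ g)(x) = (2π)⁻¹ ∫ f(y) g(x-y) dy`. -/
def convT (f g : Tor → ℝ) (x : Tor) : ℝ := ∫ y, f y * g (x - y) ∂haarT

/-- The kernel `φ_L(x) = L (1 + L² sin²(x/2))^{-3/4}` on the torus. -/
def phi (L : ℝ) : Tor → ℝ :=
  Function.Periodic.lift (c := 2 * π)
    (f := fun x : ℝ => L * (1 + L ^ 2 * Real.sin (x / 2) ^ 2) ^ (-(3:ℝ)/4))
    (by
      intro x
      simp only []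
      have h : (x + 2 * π) / 2 = x / 2 + π := by ring
      rw [h, Real.sin_add_pi]
      ring_nf)

/-- The (open) arc of the torus with centre `c : ℝ` and arclength `ℓ`. -/
def arc (c ℓ : ℝ) : Set Tor := (fun t : ℝ => (t : Tor)) '' Set.Ioo (c - ℓ / 2) (c + ℓ / 2)

theorem phi_coe (L t : ℝ) :
    phi L (t : Tor) = L * (1 + L ^ 2 * Real.sin (t / 2) ^ 2) ^ (-(3 : ℝ) / 4) := rfl

theorem phi_nonneg {L : ℝ} (hL : 0 ≤ L) (x : Tor) : 0 ≤ phi L x := by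
  induction x using QuotientAddGroup.induction_on with
  | H t =>
    rw [phi_coe]
    positivity

theorem continuous_phi (L : ℝ) : Continuous (phi L) := by
  refine continuous_coinduced_dom.2 (?_ : Continuous fun t : ℝ =>
    L * (1 + L ^ 2 * Real.sin (t / 2) ^ 2) ^ (-(3 : ℝ) / 4))
  refine continuous_const.mul (Continuous.rpow_const (by fun_prop) fun t => Or.inl ?_)
  positivity

/-- The kernel `φ_L` is essentially constant at scale `L⁻¹`. -/
theorem phi_coe_le_two_mul {L s t : ℝ} (hL : 0 < L) (h : L * |s - t| ≤ 1) :
    phi L (s : Tor) ≤ 2 * phi L (t : Tor) := by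
  rw [phi_coe, phi_coe]
  have hsin : |L * (Real.sin (t / 2) - Real.sin (s / 2))| ≤ 1 / 2 := by
    have h1 := Real.abs_sin_sub_sin_le (t / 2) (s / 2)
    rw [← sub_div, abs_div, abs_two, abs_sub_comm t s] at h1
    rw [abs_mul, abs_of_pos hL]
    nlinarith
  have hbase : 1 + L ^ 2 * Real.sin (t / 2) ^ 2 ≤ 2 * (1 + L ^ 2 * Real.sin (s / 2) ^ 2) := by
    obtain ⟨h1, h2⟩ := abs_le.1 hsin
    nlinarith [sq_nonneg (L * (Real.sin (t / 2) - 2 * Real.sin (s / 2)))]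
  have hs : 0 < 1 + L ^ 2 * Real.sin (s / 2) ^ 2 := by positivity
  have ht : 0 < 1 + L ^ 2 * Real.sin (t / 2) ^ 2 := by positivity
  have h1 := Real.rpow_le_rpow_of_nonpos ht hbase (by norm_num : -(3 : ℝ) / 4 ≤ 0)
  rw [Real.mul_rpow zero_le_two hs.le] at h1
  have h2 : (1 : ℝ) / 2 ≤ 2 ^ (-(3 : ℝ) / 4) := by
    rw [one_div, ← Real.rpow_neg_one]
    exact Real.rpow_le_rpow_of_exponent_le one_le_two (by norm_num)
  have h3 := mul_le_mul_of_nonneg_right h2 (Real.rpow_nonneg hs.le (-(3 : ℝ) / 4))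
  nlinarith

theorem isOpen_arc (c ℓ : ℝ) : IsOpen (arc c ℓ) :=
  QuotientAddGroup.isOpenMap_coe _ isOpen_Ioo

instance : IsProbabilityMeasure haarT :=
  inferInstanceAs (IsProbabilityMeasure (AddCircle.haarAddCircle (T := 2 * π)))

theorem le_two_pi_mul_haarT_arc {c ℓ : ℝ} (hℓ : 0 ≤ ℓ) (hℓ' : ℓ ≤ 2 * π) :
    ℓ ≤ 2 * π * haarT.real (arc c ℓ) := by
  have hvol : ENNReal.ofReal ℓ ≤ (volume : Measure Tor) (arc c ℓ) := by
    rw [← (AddCircle.measurePreserving_mk (2 * π) (c - ℓ / 2)).measure_preimage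
      (isOpen_arc c ℓ).measurableSet.nullMeasurableSet]
    calc ENNReal.ofReal ℓ = volume (Set.Ioo (c - ℓ / 2) (c + ℓ / 2)) := by
          rw [Real.volume_Ioo]; ring_nf
      _ = volume.restrict (Set.Ioc (c - ℓ / 2) (c - ℓ / 2 + 2 * π))
            (Set.Ioo (c - ℓ / 2) (c + ℓ / 2)) := by
          refine (Measure.restrict_eq_self _ fun t (ht : t ∈ Set.Ioo _ _) => ?_).symm
          exact ⟨ht.1, by linarith [ht.2]⟩
      _ ≤ _ := measure_mono (Set.subset_preimage_image _ _)
  rw [AddCircle.volume_eq_smul_haarAddCircle, Measure.smul_apply, smul_eq_mul] at hvol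
  have h := ENNReal.toReal_mono
    (ENNReal.mul_ne_top ENNReal.ofReal_ne_top (measure_ne_top haarT (arc c ℓ))) hvol
  rwa [ENNReal.toReal_ofReal hℓ, ENNReal.toReal_mul, ENNReal.toReal_ofReal (by positivity)] at h

theorem phi_sub_le_two_mul {c ℓ L : ℝ} (hL : 0 < L) (h : L * ℓ ≤ 1) (x : Tor) {y z : Tor}
    (hy : y ∈ arc c ℓ) (hz : z ∈ arc c ℓ) : phi L (x - y) ≤ 2 * phi L (x - z) := by
  obtain ⟨s, hs, rfl⟩ := hy
  obtain ⟨t, ht, rfl⟩ := hz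
  induction x using QuotientAddGroup.induction_on with
  | H u =>
    refine phi_coe_le_two_mul (s := u - s) (t := u - t) hL (le_trans ?_ h)
    gcongr
    rw [abs_le]
    constructor <;> linarith [hs.1, hs.2, ht.1, ht.2]

/-- Pointwise domination of `φ_L` by the convolution of `φ_L` with the indicator of an arc. -/
theorem phi_sub_le_convT_arc {c ℓ L : ℝ} (hℓ : 0 < ℓ) (hℓ' : ℓ ≤ 2 * π) (hL : 0 < L)
    (h : L * ℓ ≤ 1) (x : Tor) {y : Tor} (hy : y ∈ arc c ℓ) :
    phi L (x - y) ≤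
      4 * π * ℓ⁻¹ * convT ((arc c ℓ).indicator fun _ => (1 : ℝ)) (phi L) x := by
  have hm := (isOpen_arc c ℓ).measurableSet
  have hint : Integrable (fun z => phi L (x - z)) haarT :=
    ((continuous_phi L).comp (continuous_const.sub continuous_id)).integrable_of_hasCompactSupport
      (HasCompactSupport.of_compactSpace _)
  have hconv : convT ((arc c ℓ).indicator fun _ => (1 : ℝ)) (phi L) x =
      ∫ z in arc c ℓ, phi L (x - z) ∂haarT := by
    rw [← integral_indicator hm]
    refine integral_congr_ae (.of_forall fun z => ?_)
    by_cases hz : z ∈ arc c ℓ <;> simp [hz]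
  have hlow : haarT.real (arc c ℓ) * (phi L (x - y) / 2) ≤
      ∫ z in arc c ℓ, phi L (x - z) ∂haarT := by
    rw [← smul_eq_mul, ← setIntegral_const]
    refine setIntegral_mono_on (integrable_const _) hint.integrableOn hm fun z hz => ?_
    linarith [phi_sub_le_two_mul hL h x hy hz]
  have hmul := mul_le_mul_of_nonneg_right (le_two_pi_mul_haarT_arc (c := c) hℓ.le hℓ')
    (phi_nonneg hL.le (x - y))
  rw [hconv, mul_right_comm, ← div_eq_mul_inv, le_div_iff₀ hℓ]
  nlinarith [mul_le_mul_of_nonneg_left hlow (by positivity : 0 ≤ 4 * π)]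

/-- There is an absolute constant `A₀ > 0` such that for every arc `J` with `|J| ≤ 1/8`,
every `L > 0` with `L·|J| ≤ 1`, and every `b ∈ L¹(𝕋)` supported in `J`, one has
`|(b ∗ φ_L)(x)| ≤ A₀ ‖b‖_{L¹} |J|⁻¹ (χ_J ∗ φ_L)(x)` for all `x ∈ 𝕋`. -/
theorem statement10 :
    ∃ A₀ : ℝ, 0 < A₀ ∧
      ∀ (c ℓ : ℝ), 0 < ℓ → ℓ ≤ 1 / 8 →
      ∀ L : ℝ, 0 < L → L * ℓ ≤ 1 →
      ∀ b : Tor → ℝ, Integrable b haarT →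
        (∀ x : Tor, x ∉ arc c ℓ → b x = 0) →
        ∀ x : Tor,
          |convT b (phi L) x| ≤
            A₀ * (∫ y, |b y| ∂haarT) * ℓ⁻¹ *
              convT ((arc c ℓ).indicator fun _ => (1:ℝ)) (phi L) x := by
  refine ⟨4 * π, by positivity, fun c ℓ hℓ hℓ' L hL hLℓ b hb hsupp x => ?_⟩
  have hpi : ℓ ≤ 2 * π := by linarith [Real.pi_gt_three]
  set K := convT ((arc c ℓ).indicator fun _ => (1 : ℝ)) (phi L) x
  calc |convT b (phi L) x| ≤ ∫ y, |b y * phi L (x - y)| ∂haarT := abs_integral_le_integral_abs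
    _ ≤ ∫ y, |b y| * (4 * π * ℓ⁻¹ * K) ∂haarT := by
        refine integral_mono_of_nonneg (.of_forall fun y => abs_nonneg _)
          (hb.abs.mul_const _) (.of_forall fun y => ?_)
        by_cases hy : y ∈ arc c ℓ
        · simp only [abs_mul, abs_of_nonneg (phi_nonneg hL.le (x - y))]
          gcongr
          exact phi_sub_le_convT_arc hℓ hpi hL hLℓ x hy
        · simp [hsupp y hy]
    _ = 4 * π * (∫ y, |b y| ∂haarT) * ℓ⁻¹ * K := by
        rw [integral_mul_const]
        ring

end
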